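/- arXiv:1504.02587 — 5 statements merged into one kernel-verified Lean document; each statement's English description precedes it below -/
import Mathlib

section
/- Let 𝒯 be a stubborn set assignment satisfying D0, D1 and D2. Let s be an r-state and s_t a terminal state such that s →[t₁⋯tₙ] s_t. Then there is an r-path from s to s_t whose sequence of transitions is a permutation of t₁⋯tₙ. -/
/-- `TPath step s σ s'` means `s →[σ] s'`: firing the sequence `σ` of transitions
from `s` yields `s'`. -/
inductive TPath {S T : Type*} (step : S → T → S → Prop) : S → List T → S → Prop
  | nil (s : S) : TPath step s [] s
  | cons {s s' s'' : S} {t : T} {σ : List T} :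
      step s t s' → TPath step s' σ s'' → TPath step s (t :: σ) s''

/-- Transition `t` is enabled at `s`. -/
def Enabled {S T : Type*} (step : S → T → S → Prop) (s : S) (t : T) : Prop :=
  ∃ s', step s t s'

/-- A state is terminal iff no transition is enabled at it. -/
def Terminal {S T : Type*} (step : S → T → S → Prop) (s : S) : Prop :=
  ∀ t, ¬ Enabled step s t

/-- `s'` is reachable from `s`. -/
def Reachable {S T : Type*} (step : S → T → S → Prop) (s s' : S) : Prop :=
  ∃ σ, TPath step s σ s'

/-- An r-edge: a step `s →[t] s'` with `t ∈ 𝒯 s`. -/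
def REdge {S T : Type*} (step : S → T → S → Prop) (𝒯 : S → Set T)
    (s : S) (t : T) (s' : S) : Prop :=
  step s t s' ∧ t ∈ 𝒯 s

/-- The transition relation is deterministic. -/
def Deterministic {S T : Type*} (step : S → T → S → Prop) : Prop :=
  ∀ s t s₁ s₂, step s t s₁ → step s t s₂ → s₁ = s₂

/-- D0: if `s₀` is not terminal then `𝒯 s₀` contains an enabled transition. -/
def D0 {S T : Type*} (step : S → T → S → Prop) (𝒯 : S → Set T) : Prop :=
  ∀ s₀, ¬ Terminal step s₀ → ∃ t ∈ 𝒯 s₀, Enabled step s₀ t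

/-- D1: if `t ∈ 𝒯 s₀`, `t₁,…,tₙ ∉ 𝒯 s₀` and `s₀ →[t₁⋯tₙ t] s'`
then `s₀ →[t t₁⋯tₙ] s'`. -/
def D1 {S T : Type*} (step : S → T → S → Prop) (𝒯 : S → Set T) : Prop :=
  ∀ s₀ t σ s', t ∈ 𝒯 s₀ → (∀ u ∈ σ, u ∉ 𝒯 s₀) →
    TPath step s₀ (σ ++ [t]) s' → TPath step s₀ (t :: σ) s'

/-- D2: if `t ∈ 𝒯 s₀` is enabled at `s₀`, `t₁,…,tₙ ∉ 𝒯 s₀` and `s₀ →[t₁⋯tₙ] sₙ`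
then `t` is enabled at `sₙ`. -/
def D2 {S T : Type*} (step : S → T → S → Prop) (𝒯 : S → Set T) : Prop :=
  ∀ s₀ t σ sₙ, t ∈ 𝒯 s₀ → Enabled step s₀ t → (∀ u ∈ σ, u ∉ 𝒯 s₀) →
    TPath step s₀ σ sₙ → Enabled step sₙ t

theorem TPath.append {S T : Type*} {step : S → T → S → Prop} {s s' s'' : S} {α β : List T}
    (hα : TPath step s α s') (hβ : TPath step s' β s'') : TPath step s (α ++ β) s'' := by
  induction hα with
  | nil => exact hβ
  | cons hstep _ ih => exact .cons hstep (ih hβ)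

theorem TPath.exists_of_append {S T : Type*} {step : S → T → S → Prop} {s s'' : S}
    {α β : List T} (h : TPath step s (α ++ β) s'') :
    ∃ s', TPath step s α s' ∧ TPath step s' β s'' := by
  induction α generalizing s with
  | nil => exact ⟨s, .nil s, h⟩
  | cons t α ih =>
    cases h with
    | cons hstep h =>
      obtain ⟨s', hα, hβ⟩ := ih h
      exact ⟨s', .cons hstep hα, hβ⟩

/-- A list containing an element of `A` splits at the first such element. -/
theorem List.exists_first_mem_split {T : Type*} (A : Set T) {σ : List T} (h : ∃ u ∈ σ, u ∈ A) :
    ∃ α t β, σ = α ++ t :: β ∧ t ∈ A ∧ ∀ u ∈ α, u ∉ A := by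
  induction σ with
  | nil => simp at h
  | cons x σ ih =>
    by_cases hx : x ∈ A
    · exact ⟨[], x, σ, rfl, hx, by simp⟩
    · obtain ⟨α, t, β, rfl, ht, hα⟩ := ih (by simpa [hx] using h)
      exact ⟨x :: α, t, β, rfl, ht, by simpa [hx] using hα⟩

/-- A nonempty path to a terminal state can be reordered so that it starts with an r-edge. -/
theorem TPath.exists_perm_cons_rEdge {S T : Type*} {step : S → T → S → Prop} {𝒯 : S → Set T}
    (h0 : D0 step 𝒯) (h1 : D1 step 𝒯) (h2 : D2 step 𝒯) {s s_t : S} {σ : List T} (hσ : σ ≠ [])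
    (hterm : Terminal step s_t) (hpath : TPath step s σ s_t) :
    ∃ t s' τ, (t :: τ).Perm σ ∧ REdge step 𝒯 s t s' ∧ TPath step s' τ s_t := by
  have hs : ¬ Terminal step s := by
    cases hpath with
    | nil => exact absurd rfl hσ
    | cons hstep _ => exact fun h => h _ ⟨_, hstep⟩
  obtain ⟨k, hk, hk_enabled⟩ := h0 s hs
  have hmem : ∃ u ∈ σ, u ∈ 𝒯 s := by
    by_contra! h
    exact hterm k (h2 s k σ s_t hk hk_enabled h hpath)
  obtain ⟨α, t, β, rfl, ht, hα⟩ := List.exists_first_mem_split (𝒯 s) hmem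
  rw [List.append_cons] at hpath
  obtain ⟨r, hαt, hβ⟩ := hpath.exists_of_append
  cases h1 s t α r ht hα hαt with
  | cons hstep hα_path =>
    exact ⟨t, _, α ++ β, List.perm_middle.symm, ⟨hstep, ht⟩, hα_path.append hβ⟩

/-- Theorem 1 (first claim): if `s` is an r-state and `s_t` a terminal state with
`s →[t₁⋯tₙ] s_t`, then there is an r-path from `s` to `s_t` whose sequence of
transitions is a permutation of `t₁⋯tₙ`. -/
theorem stmt0 {S T : Type*} (step : S → T → S → Prop) (𝒯 : S → Set T) (sHat : S)
    (hdet : Deterministic step) (h0 : D0 step 𝒯) (h1 : D1 step 𝒯) (h2 : D2 step 𝒯)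
    (s s_t : S) (σ : List T)
    (hs : Reachable (REdge step 𝒯) sHat s)
    (hterm : Terminal step s_t)
    (hpath : TPath step s σ s_t) :
    ∃ σ' : List T, σ'.Perm σ ∧ TPath (REdge step 𝒯) s σ' s_t := by
  clear hs
  induction hn : σ.length generalizing s σ with
  | zero =>
    obtain rfl := List.length_eq_zero_iff.mp hn
    cases hpath
    exact ⟨[], .nil, .nil _⟩
  | succ n ih =>
    obtain ⟨t, s', τ, hperm, hedge, hτ⟩ :=
      hpath.exists_perm_cons_rEdge h0 h1 h2 (List.ne_nil_of_length_eq_add_one hn) hterm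
    have hlen : τ.length = n := by
      have := hperm.length_eq
      simp only [List.length_cons] at this
      lia
    obtain ⟨σ', hσ', hr⟩ := ih s' τ hτ hlen
    exact ⟨t :: σ', (hσ'.cons t).trans hperm, .cons hedge hr⟩
end

section
/- Let 𝒯 be a stubborn set assignment satisfying D0, D1 and D2. Let s be a state, n ≥ 1, and s_t a terminal state with s →[t₁⋯tₙ] s_t. Then there is an index i with 1 ≤ i ≤ n such that tᵢ ∈ 𝒯(s), none of t₁,…,t_{i−1} is in 𝒯(s), and there is a state s' with s →[tᵢ] s' (an r-edge) and s' →[t₁⋯t_{i−1} t_{i+1}⋯tₙ] s_t. -/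
/-- A path along `σ ++ τ` splits at an intermediate state. -/
theorem tpath_append_iff {S T : Type*} {step : S → T → S → Prop} {s s' : S} {σ τ : List T} :
    TPath step s (σ ++ τ) s' ↔ ∃ m, TPath step s σ m ∧ TPath step m τ s' := by
  induction σ generalizing s with
  | nil =>
    refine ⟨fun h => ⟨s, .nil s, h⟩, ?_⟩
    rintro ⟨m, h, h'⟩
    cases h
    exact h'
  | cons t σ ih =>
    constructor
    · intro h
      cases h with
      | cons hst hrest =>
        obtain ⟨m, hm, hm'⟩ := ih.mp hrest
        exact ⟨m, .cons hst hm, hm'⟩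
    · rintro ⟨m, h, h'⟩
      cases h with
      | cons hst hrest => exact .cons hst (ih.mpr ⟨m, hrest, h'⟩)

/-- A list with an element satisfying `p` splits at its first such element. -/
theorem List.exists_eq_append_cons_first {α : Type*} {p : α → Prop} {l : List α}
    (h : ∃ x ∈ l, p x) :
    ∃ a x b, l = a ++ x :: b ∧ p x ∧ ∀ y ∈ a, ¬ p y := by
  induction l with
  | nil => simp at h
  | cons c l ih =>
    by_cases hc : p c
    · exact ⟨[], c, l, rfl, hc, by simp⟩
    · obtain ⟨a, x, b, rfl, hx, ha⟩ := ih (by simpa [hc] using h)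
      exact ⟨c :: a, x, b, rfl, hx, by simpa [hc] using ha⟩

/-- A nonempty path to a terminal state fires some transition of the stubborn set
at its first state. -/
theorem exists_mem_stubborn_of_tpath_terminal {S T : Type*} {step : S → T → S → Prop}
    {𝒯 : S → Set T} (h0 : D0 step 𝒯) (h2 : D2 step 𝒯) {s s_t : S} {σ : List T}
    (hne : σ ≠ []) (hterm : Terminal step s_t) (hpath : TPath step s σ s_t) :
    ∃ t ∈ σ, t ∈ 𝒯 s := by
  by_contra! hcon
  have hs : ¬ Terminal step s := by
    cases hpath with
    | nil => exact absurd rfl hne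
    | cons hst _ => exact fun h => h _ ⟨_, hst⟩
  obtain ⟨t, ht, hen⟩ := h0 s hs
  exact hterm t (h2 s t σ s_t ht hen hcon hpath)

/-- Induction step of the proof of Theorem 1: if `s →[t₁⋯tₙ] s_t` with `s_t`
terminal and `n ≥ 1`, then there is an index `i` such that `tᵢ ∈ 𝒯 s`, none of
`t₁,…,t_{i-1}` is in `𝒯 s`, and there is a state `s'` with `s →[tᵢ] s'` an
r-edge and `s' →[t₁⋯t_{i-1}t_{i+1}⋯tₙ] s_t`. -/
theorem stmt2 {S T : Type*} (step : S → T → S → Prop) (𝒯 : S → Set T)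
    (hdet : Deterministic step) (h0 : D0 step 𝒯) (h1 : D1 step 𝒯) (h2 : D2 step 𝒯)
    (s s_t : S) (σ : List T) (hne : σ ≠ [])
    (hterm : Terminal step s_t)
    (hpath : TPath step s σ s_t) :
    ∃ i : Fin σ.length, σ.get i ∈ 𝒯 s ∧
      (∀ j : Fin σ.length, j < i → σ.get j ∉ 𝒯 s) ∧
      ∃ s', REdge step 𝒯 s (σ.get i) s' ∧ TPath step s' (σ.eraseIdx i) s_t := by
  obtain ⟨a, t, b, rfl, ht, ha⟩ := List.exists_eq_append_cons_first
    (exists_mem_stubborn_of_tpath_terminal h0 h2 hne hterm hpath)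
  rw [List.append_cons, tpath_append_iff] at hpath
  obtain ⟨m, hat, hb⟩ := hpath
  cases h1 s t a m ht ha hat with
  | cons hst hrest =>
    refine ⟨⟨a.length, by simp⟩, by simpa using ht, ?_, _, ⟨by simpa using hst, by simpa using ht⟩, ?_⟩
    · intro j hj
      have hj' : j.1 < a.length := hj
      rw [List.get_eq_getElem, List.getElem_append_left hj']
      exact ha _ (List.getElem_mem hj')
    · simpa [List.eraseIdx_append_of_length_le] using tpath_append_iff.mpr ⟨m, hrest, hb⟩
end

section
/- Let 𝒯 be a stubborn set assignment satisfying D0, D1 and D2, and assume the system is AG EF terminating. Then from every r-state there is a path consisting of r-edges leading to a terminal state. -/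
theorem TPath.append_iff {S T : Type*} {step : S → T → S → Prop} {s s' : S} {σ τ : List T} :
    TPath step s (σ ++ τ) s' ↔ ∃ u, TPath step s σ u ∧ TPath step u τ s' := by
  constructor
  · intro h
    induction σ generalizing s with
    | nil => exact ⟨s, .nil s, h⟩
    | cons t σ ih =>
      cases h with
      | cons hs hp =>
        obtain ⟨u, h₁, h₂⟩ := ih hp
        exact ⟨u, .cons hs h₁, h₂⟩
  · rintro ⟨u, h₁, h₂⟩
    induction h₁ with
    | nil => exact h₂
    | cons hs _ ih => exact .cons hs (ih h₂)

theorem TPath.mono {S T : Type*} {step step' : S → T → S → Prop}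
    (h : ∀ s t s', step s t s' → step' s t s') {s s' : S} {σ : List T}
    (hp : TPath step s σ s') : TPath step' s σ s' := by
  induction hp with
  | nil s => exact .nil s
  | cons hs _ ih => exact .cons (h _ _ _ hs) ih

/-- A list meeting `A` splits at its first element in `A`. -/
theorem List.exists_eq_append_cons_first_s6 {T : Type*} {A : Set T} {σ : List T}
    (h : ∃ u ∈ σ, u ∈ A) :
    ∃ α t β, σ = α ++ t :: β ∧ t ∈ A ∧ ∀ u ∈ α, u ∉ A := by
  induction σ with
  | nil => simp at h
  | cons a σ ih =>
    by_cases ha : a ∈ A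
    · exact ⟨[], a, σ, rfl, ha, by simp⟩
    · obtain ⟨α, t, β, rfl, ht, hα⟩ := ih (by simpa [ha] using h)
      exact ⟨a :: α, t, β, rfl, ht, by simpa [ha] using hα⟩

/-- Every path to a terminal state can be replaced by a path of r-edges to the same state. -/
theorem TPath.reachable_rEdge_of_terminal {S T : Type*} {step : S → T → S → Prop}
    {𝒯 : S → Set T} (h0 : D0 step 𝒯) (h1 : D1 step 𝒯) (h2 : D2 step 𝒯) {s s' : S} {σ : List T}
    (hp : TPath step s σ s') (hs' : Terminal step s') : Reachable (REdge step 𝒯) s s' := by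
  induction hn : σ.length generalizing s σ with
  | zero =>
    obtain rfl := List.length_eq_zero_iff.mp hn
    cases hp
    exact ⟨[], .nil _⟩
  | succ n ih =>
    have hs : ¬ Terminal step s := by
      intro hs
      cases hp with
      | nil => simp at hn
      | cons h _ => exact hs _ ⟨_, h⟩
    obtain ⟨t, ht, hen⟩ := h0 s hs
    have hmeet : ∃ u ∈ σ, u ∈ 𝒯 s := by
      by_contra! hσ
      exact hs' t (h2 s t σ s' ht hen hσ hp)
    obtain ⟨α, t, β, rfl, ht, hα⟩ := List.exists_eq_append_cons_first_s6 hmeet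
    rw [← List.singleton_append, ← List.append_assoc] at hp
    obtain ⟨u, hu, hβ⟩ := TPath.append_iff.mp hp
    cases h1 s t α u ht hα hu with
    | cons hst hrest =>
      obtain ⟨τ, hτ⟩ := ih (TPath.append_iff.mpr ⟨u, hrest, hβ⟩) (by
        simp only [List.length_append, List.length_cons] at hn ⊢
        omega)
      exact ⟨t :: τ, .cons ⟨hst, ht⟩ hτ⟩

/-- If the system is AG EF terminating, then from every r-state there is a path
consisting of r-edges leading to a terminal state. -/
theorem stmt6 {S T : Type*} (step : S → T → S → Prop) (𝒯 : S → Set T) (sHat : S)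
    (hdet : Deterministic step) (h0 : D0 step 𝒯) (h1 : D1 step 𝒯) (h2 : D2 step 𝒯)
    (hAGEF : ∀ s, Reachable step sHat s →
      ∃ s_t, Terminal step s_t ∧ Reachable step s s_t) :
    ∀ s, Reachable (REdge step 𝒯) sHat s →
      ∃ s_t, Terminal step s_t ∧ Reachable (REdge step 𝒯) s s_t := by
  rintro s ⟨σ, hσ⟩
  obtain ⟨s_t, hterm, τ, hτ⟩ := hAGEF s ⟨σ, hσ.mono fun _ _ _ h => h.1⟩
  exact ⟨s_t, hterm, hτ.reachable_rEdge_of_terminal h0 h1 h2 hterm⟩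
end

section
/- Assume the set S of states is finite with cardinality N, and let 𝒯 be any function from states to sets of transitions. Let t_ω be a transition and T_* a set of transitions. Suppose there exist finite sequences α and γ of transitions and a state s' such that ŝ →[α γ] s' along r-edges, γ contains more than N occurrences of t_ω, and γ contains no occurrence of any member of T_*. Then there exists an infinite r-execution from ŝ in which t_ω occurs infinitely many times but each member of T_* occurs only finitely many times. -/
/-- A finite path visits a sequence of states indexed by the positions in its label sequence. -/
theorem TPath.exists_states {S T : Type*} {step : S → T → S → Prop} {s s' : S} {σ : List T}
    (h : TPath step s σ s') :
    ∃ f : ℕ → S, f 0 = s ∧ ∀ i (hi : i < σ.length), step (f i) σ[i] (f (i + 1)) := by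
  induction h with
  | nil s => exact ⟨fun _ => s, rfl, by simp⟩
  | @cons s _ _ _ _ hstep _ ih =>
    obtain ⟨f, hf0, hf⟩ := ih
    refine ⟨fun n => Nat.casesOn n s f, rfl, ?_⟩
    rintro (_ | i) hi
    · simpa [hf0] using hstep
    · simpa using hf i (by simpa using hi)

/-- If `a` occurs in `l` more often than there are states, then two positions carrying `a`
are assigned the same state. -/
theorem List.exists_lt_getElem_eq_of_card_lt_count {S T : Type*} [Finite S] [DecidableEq T]
    (l : List T) (a : T) (f : ℕ → S) (h : Nat.card S < l.count a) :
    ∃ (i j : ℕ) (hij : i < j) (hj : j < l.length), l[i] = a ∧ f i = f j := by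
  classical
  have := Fintype.ofFinite S
  have hcard : (Finset.univ.filter fun i : Fin l.length => l[i] = a).card = l.count a :=
    Fin.card_filter_univ_eq_vector_get_eq_count a (⟨l, rfl⟩ : List.Vector T l.length)
  rw [Nat.card_eq_fintype_card, ← Finset.card_univ, ← hcard] at h
  obtain ⟨x, hx, y, hy, hne, hxy⟩ := Finset.exists_ne_map_eq_of_card_lt_of_maps_to h
    (f := fun i : Fin l.length => f i) (fun _ _ => Finset.mem_coe.2 (Finset.mem_univ _))
  simp only [Finset.mem_filter, Finset.mem_univ, true_and] at hx hy
  rcases lt_or_gt_of_ne hne with hlt | hlt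
  · exact ⟨x, y, hlt, y.2, hx, hxy⟩
  · exact ⟨y, x, hlt, x.2, hy, hxy.symm⟩

/-- The position reached after `n` steps when going from `0` to `i` and then cycling
through the `p` positions starting at `i`. -/
def lassoIndex (i p n : ℕ) : ℕ :=
  if n < i then n else i + (n - i) % p

theorem lassoIndex_lt {i p : ℕ} (hp : 0 < p) (n : ℕ) : lassoIndex i p n < i + p := by
  have := Nat.mod_lt (n - i) hp
  unfold lassoIndex
  split_ifs <;> omega

theorem le_lassoIndex {i p n : ℕ} (hn : i ≤ n) : i ≤ lassoIndex i p n := by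
  simp [lassoIndex, hn.not_gt]

theorem lassoIndex_zero (i p : ℕ) : lassoIndex i p 0 = 0 := by
  unfold lassoIndex
  split_ifs with h
  · rfl
  · simp [Nat.eq_zero_of_not_pos h]

theorem lassoIndex_add_mul (i p k : ℕ) : lassoIndex i p (i + p * k) = i := by
  simp [lassoIndex]

/-- A function taking equal values at `i` and `i + p` sees no jump along the lasso. -/
theorem map_lassoIndex_succ {S : Type*} {f : ℕ → S} {i p : ℕ} (hp : 0 < p)
    (h : f i = f (i + p)) (n : ℕ) :
    f (lassoIndex i p (n + 1)) = f (lassoIndex i p n + 1) := by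
  by_cases hn : n + 1 < i
  · simp [lassoIndex, hn, show n < i by omega]
  by_cases hn' : n < i
  · simp [lassoIndex, hn', show n + 1 = i by omega]
  have hlt := Nat.mod_lt (n - i) hp
  simp only [lassoIndex, hn, hn', if_false, show n + 1 - i = (n - i) + 1 by omega]
  by_cases hmod : (n - i) % p + 1 = p
  · rw [← Nat.mod_add_mod, hmod, Nat.mod_self, add_assoc, hmod, add_zero, h]
  · rw [← Nat.mod_add_mod, Nat.mod_eq_of_lt (by omega), add_assoc]

/-- If the reduced state space of a system with `N` states contains an r-path
`sHat →[α γ] s'` where `γ` has more than `N` occurrences of `t_ω` and no occurrence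
of any member of `T_*`, then there is an infinite r-execution from `sHat` in which
`t_ω` occurs infinitely often but each member of `T_*` only finitely often. -/
theorem stmt15 {S T : Type*} [Finite S] [DecidableEq T]
    (step : S → T → S → Prop) (𝒯 : S → Set T) (sHat : S)
    (hdet : Deterministic step)
    (N : ℕ) (hN : Nat.card S = N)
    (t_ω : T) (T_star : Set T)
    (hpath : ∃ (α γ : List T) (s' : S),
      TPath (REdge step 𝒯) sHat (α ++ γ) s' ∧
      N < γ.count t_ω ∧ ∀ t ∈ T_star, t ∉ γ) :
    ∃ (f : ℕ → S) (g : ℕ → T), f 0 = sHat ∧ (∀ n, step (f n) (g n) (f (n + 1))) ∧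
      (∀ n, g n ∈ 𝒯 (f n)) ∧
      {n | g n = t_ω}.Infinite ∧ ∀ t ∈ T_star, ¬ {n | g n = t}.Infinite := by
  obtain ⟨α, γ, s', hp, hcount, hstar⟩ := hpath
  obtain ⟨f, hf0, hf⟩ := hp.exists_states
  obtain ⟨i, j, hij, hj, hi, hfij⟩ := γ.exists_lt_getElem_eq_of_card_lt_count t_ω
    (fun k => f (α.length + k)) (hN ▸ hcount)
  have hpos : 0 < j - i := Nat.sub_pos_of_lt hij
  have hlen (n : ℕ) : lassoIndex (α.length + i) (j - i) n < (α ++ γ).length := by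
    have := lassoIndex_lt (i := α.length + i) hpos n
    rw [List.length_append]
    omega
  have hcycle : f (α.length + i) = f (α.length + i + (j - i)) := by
    rw [show α.length + i + (j - i) = α.length + j by omega]
    exact hfij
  have hedge (n : ℕ) := map_lassoIndex_succ hpos hcycle n ▸ hf _ (hlen n)
  refine ⟨fun n => f (lassoIndex (α.length + i) (j - i) n),
    fun n => (α ++ γ)[lassoIndex (α.length + i) (j - i) n]'(hlen n),
    by simp [lassoIndex_zero, hf0], fun n => (hedge n).1, fun n => (hedge n).2, ?_, ?_⟩
  · refine Set.infinite_of_injective_forall_mem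
      (f := fun k => α.length + i + (j - i) * k) (fun a b hab => ?_) fun k => ?_
    · exact Nat.eq_of_mul_eq_mul_left hpos (Nat.add_left_cancel hab)
    · simp [lassoIndex_add_mul, hi]
  · intro t ht
    rw [Set.not_infinite]
    refine (Set.finite_Iio (α.length + i)).subset fun n hn => ?_
    by_contra hge
    have hle := le_lassoIndex (p := j - i) (not_lt.1 hge)
    rw [Set.mem_ofPred_eq] at hn
    beta_reduce at hn
    rw [List.getElem_append_right ((Nat.le_add_right _ _).trans hle)] at hn
    exact hstar t ht (hn ▸ List.getElem_mem _)
end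

section
/- Fix a state s₀, a set 𝒯(s₀) of transitions, and a transition t_c ∉ 𝒯(s₀) whose occurrence never changes the state (for all s, s', s →[t_c] s' implies s' = s). Suppose: (a) D1 holds at s₀ for sequences avoiding 𝒯(s₀) ∪ {t_c}: for every t ∈ 𝒯(s₀) and every t₁,…,tₙ ∉ 𝒯(s₀) with each tᵢ ≠ t_c, s₀ →[t₁⋯tₙ t] s' implies s₀ →[t t₁⋯tₙ] s'; (b) D2 holds at s₀ for sequences avoiding 𝒯(s₀) ∪ {t_c}: for every t ∈ 𝒯(s₀) enabled at s₀ and every such sequence, s₀ →[t₁⋯tₙ] sₙ implies t is enabled at sₙ; (c) every t ∈ 𝒯(s₀) preserves enabledness of t_c: for all s, s', if s →[t] s' and t_c is enabled at s, then t_c is enabled at s'. Then for every t ∈ 𝒯(s₀), every t₁,…,tₙ ∉ 𝒯(s₀) with each tᵢ ≠ t_c, and every index i with 0 ≤ i ≤ n: if s₀ →[t₁⋯tᵢ t_c t_{i+1}⋯tₙ t] s', then s₀ →[t t₁⋯tᵢ t_c t_{i+1}⋯tₙ] s'. -/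
theorem tPath_append_iff {S T : Type*} {step : S → T → S → Prop} {σ τ : List T} {s s' : S} :
    TPath step s (σ ++ τ) s' ↔ ∃ r, TPath step s σ r ∧ TPath step r τ s' := by
  constructor
  · intro h
    induction σ generalizing s with
    | nil => exact ⟨s, .nil s, h⟩
    | cons a σ ih =>
      cases h with
      | cons ha h =>
        obtain ⟨r, h₁, h₂⟩ := ih h
        exact ⟨r, .cons ha h₁, h₂⟩
  · rintro ⟨r, h₁, h₂⟩
    induction h₁ with
    | nil => exact h₂
    | cons ha _ ih => exact .cons ha (ih h₂)

theorem tPath_cons_iff {S T : Type*} {step : S → T → S → Prop} {t : T} {σ : List T} {s s' : S} :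
    TPath step s (t :: σ) s' ↔ ∃ r, step s t r ∧ TPath step r σ s' := by
  constructor
  · rintro (_ | ⟨h, h'⟩)
    exact ⟨_, h, h'⟩
  · rintro ⟨r, h, h'⟩
    exact .cons h h'

theorem tPath_singleton_iff {S T : Type*} {step : S → T → S → Prop} {t : T} {s s' : S} :
    TPath step s [t] s' ↔ step s t s' := by
  constructor
  · rintro (_ | ⟨h, ⟨⟩⟩)
    exact h
  · exact fun h => .cons h (.nil _)

theorem Deterministic.tPath_unique {S T : Type*} {step : S → T → S → Prop}
    (hdet : Deterministic step) {σ : List T} {s s₁ s₂ : S}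
    (h₁ : TPath step s σ s₁) (h₂ : TPath step s σ s₂) : s₁ = s₂ := by
  induction h₁ with
  | nil => cases h₂; rfl
  | cons ha _ ih =>
    obtain ⟨r, hr, h₂⟩ := tPath_cons_iff.1 h₂
    cases hdet _ _ _ _ ha hr
    exact ih h₂

/-- If `t_c ∉ 𝒯(s₀)` never changes the state, D1 and D2 hold at `s₀` for
sequences avoiding `𝒯(s₀) ∪ {t_c}`, and every `t ∈ 𝒯(s₀)` preserves enabledness
of `t_c`, then D1 holds at `s₀` for sequences avoiding `𝒯(s₀)` that contain one
occurrence of `t_c`: for every `t ∈ 𝒯(s₀)` and `t₁,…,tₙ ∉ 𝒯(s₀)` with each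
`tᵢ ≠ t_c` (split as `σ₁ = t₁⋯tᵢ` and `σ₂ = t_{i+1}⋯tₙ`), if
`s₀ →[σ₁ t_c σ₂ t] s'` then `s₀ →[t σ₁ t_c σ₂] s'`. -/
theorem stmt17 {S T : Type*} (step : S → T → S → Prop)
    (hdet : Deterministic step)
    (s₀ : S) (Ts₀ : Set T) (t_c : T)
    (htc_not : t_c ∉ Ts₀)
    (htc_stutter : ∀ s s', step s t_c s' → s' = s)
    (hD1 : ∀ t ∈ Ts₀, ∀ (σ : List T) (s' : S),
      (∀ u ∈ σ, u ∉ Ts₀ ∧ u ≠ t_c) →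
      TPath step s₀ (σ ++ [t]) s' → TPath step s₀ (t :: σ) s')
    (hD2 : ∀ t ∈ Ts₀, Enabled step s₀ t →
      ∀ (σ : List T) (sₙ : S), (∀ u ∈ σ, u ∉ Ts₀ ∧ u ≠ t_c) →
        TPath step s₀ σ sₙ → Enabled step sₙ t)
    (hpreserve : ∀ t ∈ Ts₀, ∀ s s', step s t s' →
      Enabled step s t_c → Enabled step s' t_c) :
    ∀ t ∈ Ts₀, ∀ (σ₁ σ₂ : List T) (s' : S),
      (∀ u ∈ σ₁, u ∉ Ts₀ ∧ u ≠ t_c) → (∀ u ∈ σ₂, u ∉ Ts₀ ∧ u ≠ t_c) →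
      TPath step s₀ (σ₁ ++ [t_c] ++ σ₂ ++ [t]) s' →
      TPath step s₀ (t :: (σ₁ ++ [t_c] ++ σ₂)) s' := by
  intro t ht σ₁ σ₂ s' h₁ h₂ hpath
  simp only [tPath_append_iff, tPath_singleton_iff] at hpath
  obtain ⟨sₙ, ⟨c, ⟨sᵢ, hσ₁, hc⟩, hσ₂⟩, hts'⟩ := hpath
  cases htc_stutter _ _ hc
  have hσ : ∀ u ∈ σ₁ ++ σ₂, u ∉ Ts₀ ∧ u ≠ t_c := fun u hu =>
    (List.mem_append.1 hu).elim (h₁ u) (h₂ u)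
  have hcomm := hD1 t ht (σ₁ ++ σ₂) s' hσ
    (tPath_append_iff.2 ⟨sₙ, tPath_append_iff.2 ⟨_, hσ₁, hσ₂⟩, tPath_singleton_iff.2 hts'⟩)
  obtain ⟨r, hr, hcomm⟩ := tPath_cons_iff.1 hcomm
  obtain ⟨rᵢ, hrσ₁, hrσ₂⟩ := tPath_append_iff.1 hcomm
  obtain ⟨q, hq⟩ := hD2 t ht ⟨r, hr⟩ σ₁ _ h₁ hσ₁
  have hprefix := hD1 t ht σ₁ q h₁ (tPath_append_iff.2 ⟨_, hσ₁, tPath_singleton_iff.2 hq⟩)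
  cases hdet.tPath_unique hprefix (.cons hr hrσ₁)
  obtain ⟨q', hq'⟩ := hpreserve t ht _ _ hq ⟨_, hc⟩
  cases htc_stutter _ _ hq'
  exact .cons hr (tPath_append_iff.2
    ⟨_, tPath_append_iff.2 ⟨_, hrσ₁, tPath_singleton_iff.2 hq'⟩, hrσ₂⟩)
end
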